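/- The Hardy–Littlewood maximal operator M is bounded from X(ℝⁿ) to X(ℝⁿ) (i.e., there is a constant c with ‖Mf‖_{X(ℝⁿ)} ≤ c ‖f‖_{X(ℝⁿ)} for all f ∈ X(ℝⁿ)) if and only if the lower Boyd index satisfies p_X > 1. -/

import Mathlib

open MeasureTheory Set Filter Topology ENNReal

noncomputable section

/-- The decreasing rearrangement of an `ℝ≥0∞`-valued function with respect to a measure `μ`:
`g⁎(s) = sup {t : μ {x | g x > t} > s}`. -/
def distRearr {α : Type*} [MeasurableSpace α] (μ : Measure α) (g : α → ℝ≥0∞) (s : ℝ) : ℝ≥0∞ :=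
  sSup {t : ℝ≥0∞ | ENNReal.ofReal s < μ {x | t < g x}}

/-- Decreasing rearrangement of an `ℝ≥0∞`-valued function on `ℝ` (Lebesgue measure). -/
def rearrE (g : ℝ → ℝ≥0∞) : ℝ → ℝ≥0∞ := distRearr (volume : Measure ℝ) g

/-- Decreasing rearrangement `f^*` of a real-valued function on `ℝ`:
`f^*(s) = sup {t ≥ 0 : volume {x : |f x| > t} > s}`. -/
def rearr (f : ℝ → ℝ) : ℝ → ℝ≥0∞ := rearrE fun x => ENNReal.ofReal |f x|

/-- The dilation operator `D_a f (t) = f (a t)`. -/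
def dil (a : ℝ) (f : ℝ → ℝ) : ℝ → ℝ := fun t => f (a * t)

/-- The dilation operator on `ℝ≥0∞`-valued functions. -/
def dilE (a : ℝ) (g : ℝ → ℝ≥0∞) : ℝ → ℝ≥0∞ := fun t => g (a * t)

/-- A rearrangement invariant quasi-Banach function space on `ℝ` (with Lebesgue measure).
The quasi-norm `N` is defined on all `ℝ≥0∞`-valued functions (a signed function `f`
is measured via `|f|`, embedded into `ℝ≥0∞`; this is harmless since the quasi-norm of a
rearrangement invariant space depends only on `|f|`).  Membership of a signed function
`f` in the space means `f` is measurable with `N (|f|) < ∞`. -/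
structure RIQB where
  /-- the quasi-norm -/
  N : (ℝ → ℝ≥0∞) → ℝ≥0∞
  /-- the quasi-triangle inequality constant -/
  C : ℝ
  one_le_C : 1 ≤ C
  /-- homogeneity of the quasi-norm -/
  norm_smul : ∀ (c : ℝ≥0∞) (g : ℝ → ℝ≥0∞), N (fun x => c * g x) = c * N g
  /-- the quasi-triangle inequality -/
  quasi_triangle : ∀ g h : ℝ → ℝ≥0∞, AEMeasurable g volume → AEMeasurable h volume →
    N (fun x => g x + h x) ≤ ENNReal.ofReal C * (N g + N h)
  /-- definiteness (functions are identified a.e.) -/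
  definite : ∀ g : ℝ → ℝ≥0∞, AEMeasurable g volume → (N g = 0 ↔ g =ᵐ[volume] 0)
  /-- property (i): if `h^* ≤ g^*` then `‖h‖ ≤ ‖g‖` -/
  rearr_mono : ∀ g h : ℝ → ℝ≥0∞, AEMeasurable g volume → AEMeasurable h volume →
    (∀ s : ℝ, 0 < s → rearrE h s ≤ rearrE g s) → N h ≤ N g
  /-- property (ii): simple functions with support of finite measure belong to the space -/
  simple_mem : ∀ f : MeasureTheory.SimpleFunc ℝ ℝ,
    volume (Function.support (f : ℝ → ℝ)) < ∞ → N (fun x => ENNReal.ofReal |f x|) < ∞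
  /-- property (iii) or (iii′) -/
  fatou :
    (∀ g : ℕ → ℝ → ℝ≥0∞, (∀ n, AEMeasurable (g n) volume ∧ N (g n) < ∞) →
      (∀ x, Antitone fun n => g n x) → (∀ x, Tendsto (fun n => g n x) atTop (𝓝 0)) →
      Tendsto (fun n => N (g n)) atTop (𝓝 0)) ∨
    (∀ (g : ℕ → ℝ → ℝ≥0∞) (h : ℝ → ℝ≥0∞),
      (∀ n, AEMeasurable (g n) volume ∧ N (g n) < ∞) →
      (∀ x, Monotone fun n => g n x) → (∀ x, Tendsto (fun n => g n x) atTop (𝓝 (h x))) →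
      (⨆ n, N (g n)) < ∞ → N h = ⨆ n, N (g n))
  /-- completeness of the quasi-norm -/
  complete : ∀ f : ℕ → ℝ → ℝ,
    (∀ n, AEMeasurable (f n) volume ∧ N (fun x => ENNReal.ofReal |f n x|) < ∞) →
    (∀ ε : ℝ, 0 < ε → ∃ M : ℕ, ∀ m ≥ M, ∀ n ≥ M,
      N (fun x => ENNReal.ofReal |f m x - f n x|) < ENNReal.ofReal ε) →
    ∃ g : ℝ → ℝ, AEMeasurable g volume ∧ N (fun x => ENNReal.ofReal |g x|) < ∞ ∧
      Tendsto (fun n => N (fun x => ENNReal.ofReal |f n x - g x|)) atTop (𝓝 0)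

/-- The quasi-norm of a signed function. -/
def RIQB.Nr (X : RIQB) (f : ℝ → ℝ) : ℝ≥0∞ := X.N fun x => ENNReal.ofReal |f x|

/-- Membership in the space. -/
def RIQB.mem (X : RIQB) (f : ℝ → ℝ) : Prop := AEMeasurable f volume ∧ X.Nr f < ∞

/-- The lower Boyd index of a quasi-norm functional:
`sup {p > 0 : ∃ c > 0, ∀ 0 < a < 1, ∀ f ∈ X, ‖D_a f‖ ≤ c a^(-1/p) ‖f‖}`. -/
def lowerBoydOf (N : (ℝ → ℝ) → ℝ≥0∞) : ℝ≥0∞ :=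
  ⨆ p ∈ {p : ℝ | 0 < p ∧ ∃ c : ℝ, 0 < c ∧ ∀ a : ℝ, 0 < a → a < 1 →
      ∀ f : ℝ → ℝ, AEMeasurable f volume → N f < ∞ →
        N (dil a f) ≤ ENNReal.ofReal (c * a ^ (-(1/p))) * N f},
    ENNReal.ofReal p

/-- The upper Boyd index of a quasi-norm functional:
`inf {q > 0 : ∃ c > 0, ∀ a > 1, ∀ f ∈ X, ‖D_a f‖ ≤ c a^(-1/q) ‖f‖}`. -/
def upperBoydOf (N : (ℝ → ℝ) → ℝ≥0∞) : ℝ≥0∞ :=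
  ⨅ q ∈ {q : ℝ | 0 < q ∧ ∃ c : ℝ, 0 < c ∧ ∀ a : ℝ, 1 < a →
      ∀ f : ℝ → ℝ, AEMeasurable f volume → N f < ∞ →
        N (dil a f) ≤ ENNReal.ofReal (c * a ^ (-(1/q))) * N f},
    ENNReal.ofReal q

/-- The lower Boyd index `p_X`. -/
def lowerBoyd (X : RIQB) : ℝ≥0∞ := lowerBoydOf X.Nr

/-- The upper Boyd index `q_X`. -/
def upperBoyd (X : RIQB) : ℝ≥0∞ := upperBoydOf X.Nr

/-- The Hardy operator `H^{(p,r)}` acting on a nonnegative (`ℝ≥0∞`-valued) function: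
`t^{-1/p} ((r/p) ∫₀ᵗ g(s)^r s^{r/p-1} ds)^{1/r}` for `t > 0`, and `0` for `t ≤ 0`. -/
def hardyUE (p r : ℝ) (g : ℝ → ℝ≥0∞) : ℝ → ℝ≥0∞ := fun t =>
  if 0 < t then
    ENNReal.ofReal t ^ (-(1/p)) *
      (ENNReal.ofReal (r/p) *
        ∫⁻ s in Ioo (0:ℝ) t, g s ^ r * ENNReal.ofReal (s ^ (r/p - 1))) ^ (1/r)
  else 0

/-- The Hardy operator `H^{(p,r)} f (t) = t^{-1/p} ((r/p) ∫₀ᵗ f^*(s)^r s^{r/p-1} ds)^{1/r}`. -/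
def hardyU (p r : ℝ) (f : ℝ → ℝ) : ℝ → ℝ≥0∞ := hardyUE p r (rearr f)

/-- The Hardy operator `H^{(p,∞)} f (t) = sup_{0<s<t} (s/t)^{1/p} f^*(s)`. -/
def hardyUSup (p : ℝ) (f : ℝ → ℝ) : ℝ → ℝ≥0∞ := fun t =>
  if 0 < t then ⨆ s ∈ Ioo (0:ℝ) t, ENNReal.ofReal ((s/t) ^ (1/p)) * rearr f s else 0

/-- The Hardy operator
`H_{(q,r)} f (t) = t^{-1/q} ((r/q) ∫_t^∞ f^*(s)^r s^{r/q-1} ds)^{1/r}` for finite `q`. -/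
def hardyL (q r : ℝ) (f : ℝ → ℝ) : ℝ → ℝ≥0∞ := fun t =>
  if 0 < t then
    ENNReal.ofReal t ^ (-(1/q)) *
      (ENNReal.ofReal (r/q) *
        ∫⁻ s in Ioi t, rearr f s ^ r * ENNReal.ofReal (s ^ (r/q - 1))) ^ (1/r)
  else 0

/-- The Hardy operator `H_{(∞,r)} f (t) = (∫_t^∞ f^*(s)^r s⁻¹ ds)^{1/r}`. -/
def hardyLInf (r : ℝ) (f : ℝ → ℝ) : ℝ → ℝ≥0∞ := fun t =>
  if 0 < t then (∫⁻ s in Ioi t, rearr f s ^ r * ENNReal.ofReal s⁻¹) ^ (1/r) else 0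

/-- The Hardy operator `H_{(q,r)}` for `0 < q ≤ ∞`, `0 < r < ∞`. -/
def hardyLG (q : ℝ≥0∞) (r : ℝ) (f : ℝ → ℝ) : ℝ → ℝ≥0∞ :=
  if q = ∞ then hardyLInf r f else hardyL q.toReal r f

/-- The Hardy operator `H_{(q,∞)} f (t) = sup_{s>t} (s/t)^{1/q} f^*(s)`. -/
def hardyLSup (q : ℝ) (f : ℝ → ℝ) : ℝ → ℝ≥0∞ := fun t =>
  if 0 < t then ⨆ s ∈ Ioi t, ENNReal.ofReal ((s/t) ^ (1/q)) * rearr f s else 0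

/-- The Hardy operator `H^{(p,r)}` for `0 < p < ∞`, `0 < r ≤ ∞`. -/
def hardyUG (p : ℝ) (r : ℝ≥0∞) (f : ℝ → ℝ) : ℝ → ℝ≥0∞ :=
  if r = ∞ then hardyUSup p f else hardyU p r.toReal f

/-- The Hardy operator `H_{(q,s)}` for `0 < q ≤ ∞`, `0 < s ≤ ∞`
(with `H_{(∞,∞)} f = f^*`). -/
def hardyLGG (q s : ℝ≥0∞) (f : ℝ → ℝ) : ℝ → ℝ≥0∞ :=
  if q = ∞ then
    (if s = ∞ then (fun t => if 0 < t then rearr f t else 0) else hardyLInf s.toReal f)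
  else
    (if s = ∞ then hardyLSup q.toReal f else hardyL q.toReal s.toReal f)

/-- The Lorentz quasi-norm `‖f‖_{p,r}` for `0 < p ≤ ∞`, `0 < r ≤ ∞`. -/
def lorentz (p r : ℝ≥0∞) (f : ℝ → ℝ) : ℝ≥0∞ :=
  if p = ∞ then
    (if r = ∞ then essSup (fun x => ENNReal.ofReal |f x|) volume
     else (∫⁻ t in Ioi (0:ℝ), rearr f t ^ r.toReal * ENNReal.ofReal t⁻¹) ^ (1/r.toReal))
  else
    (if r = ∞ then ⨆ t ∈ Ioi (0:ℝ), ENNReal.ofReal t ^ (1/p.toReal) * rearr f t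
     else (∫⁻ t in Ioi (0:ℝ),
        (ENNReal.ofReal t ^ (1/p.toReal) * rearr f t) ^ r.toReal * ENNReal.ofReal t⁻¹) ^
          (1/r.toReal))

/-- The weak-`L_p` (Lorentz `(p,∞)`) quasi-norm of an `ℝ≥0∞`-valued function on `ℝ`:
`sup_{t>0} t^{1/p} g^*(t)`. -/
def lorentzWE (p : ℝ) (g : ℝ → ℝ≥0∞) : ℝ≥0∞ :=
  ⨆ t ∈ Ioi (0:ℝ), ENNReal.ofReal t ^ (1/p) * rearrE g t

/-- The Hardy--Littlewood maximal function on `ℝⁿ`. -/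
def maximalFn {n : ℕ} (f : EuclideanSpace ℝ (Fin n) → ℝ) (x : EuclideanSpace ℝ (Fin n)) :
    ℝ≥0∞ :=
  ⨆ (R : ℝ) (_ : 0 < R),
    (volume (Metric.ball x R))⁻¹ * ∫⁻ y in Metric.ball x R, ENNReal.ofReal |f y|

/-- The norm of the space `X(ℝⁿ)`: `‖g‖_{X(ℝⁿ)} = ‖g^*‖_X`, where the decreasing
rearrangement `g^*` (taken on `ℝⁿ`) is viewed as a function on `ℝ` supported on `(0,∞)`. -/
def XnormRn (X : RIQB) (n : ℕ) (g : EuclideanSpace ℝ (Fin n) → ℝ≥0∞) : ℝ≥0∞ :=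
  X.N fun s =>
    if 0 < s then distRearr (volume : Measure (EuclideanSpace ℝ (Fin n))) g s else 0

section DistRearr

variable {α β : Type*} [MeasurableSpace α] [MeasurableSpace β] {μ : Measure α} {ν : Measure β}

theorem lt_distRearr_iff {g : α → ℝ≥0∞} {s : ℝ} {u : ℝ≥0∞} :
    u < distRearr μ g s ↔ ENNReal.ofReal s < μ {x | u < g x} := by
  constructor
  · intro h
    obtain ⟨t, ht, hut⟩ := lt_sSup_iff.1 h
    exact lt_of_lt_of_le ht (measure_mono fun x hx => hut.trans hx)
  · intro h
    rcases eq_top_or_lt_top u with rfl | hu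
    · simp at h
    obtain ⟨v, v_anti, v_mem, v_lim⟩ := exists_seq_strictAnti_tendsto' hu
    have hU : {x | u < g x} = ⋃ n, {x | v n < g x} := by
      ext x
      simp only [mem_ofPred_eq, mem_iUnion]
      constructor
      · intro hx
        exact ((tendsto_order.1 v_lim).2 _ hx).exists
      · rintro ⟨n, hn⟩
        exact (v_mem n).1.trans hn
    have hmono : Monotone fun n => {x | v n < g x} := fun m n hmn x hx =>
      lt_of_le_of_lt (v_anti.antitone hmn) hx
    rw [hU, hmono.measure_iUnion] at h
    obtain ⟨n, hn⟩ := lt_iSup_iff.1 h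
    exact lt_of_lt_of_le (v_mem n).1 (le_sSup hn)

theorem distRearr_le_distRearr {g : α → ℝ≥0∞} {h : β → ℝ≥0∞}
    (H : ∀ u, μ {x | u < g x} ≤ ν {x | u < h x}) (s : ℝ) :
    distRearr μ g s ≤ distRearr ν h s :=
  sSup_le_sSup fun _ hu => lt_of_lt_of_le hu (H _)

theorem distRearr_mono_ae {g h : α → ℝ≥0∞} (H : g ≤ᵐ[μ] h) (s : ℝ) :
    distRearr μ g s ≤ distRearr μ h s :=
  distRearr_le_distRearr (fun _ => measure_mono_ae <| by
    filter_upwards [H] with x hx using fun hu => lt_of_lt_of_le hu hx) s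

theorem distRearr_antitone (g : α → ℝ≥0∞) : Antitone (distRearr μ g) := fun _ _ hst =>
  sSup_le_sSup fun _ hu => lt_of_le_of_lt (ENNReal.ofReal_le_ofReal hst) hu

/-- The decreasing rearrangement, viewed as a function on `ℝ` supported on `(0,∞)`. -/
def cutRearr (μ : Measure α) (g : α → ℝ≥0∞) (s : ℝ) : ℝ≥0∞ :=
  if 0 < s then distRearr μ g s else 0

theorem cutRearr_of_pos {g : α → ℝ≥0∞} {s : ℝ} (hs : 0 < s) :
    cutRearr μ g s = distRearr μ g s := if_pos hs

theorem cutRearr_of_nonpos {g : α → ℝ≥0∞} {s : ℝ} (hs : s ≤ 0) :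
    cutRearr μ g s = 0 := if_neg hs.not_gt

theorem measurable_cutRearr (g : α → ℝ≥0∞) : Measurable (cutRearr μ g) :=
  Measurable.ite measurableSet_Ioi (distRearr_antitone g).measurable measurable_const

theorem lt_cutRearr_iff {g : α → ℝ≥0∞} {s : ℝ} {u : ℝ≥0∞} :
    u < cutRearr μ g s ↔ 0 < s ∧ ENNReal.ofReal s < μ {x | u < g x} := by
  by_cases hs : 0 < s
  · simp [cutRearr_of_pos hs, lt_distRearr_iff, hs]
  · simp [cutRearr_of_nonpos (not_lt.1 hs), hs]

theorem volume_setOf_pos_and_ofReal_lt (d : ℝ≥0∞) :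
    volume {s : ℝ | 0 < s ∧ ENNReal.ofReal s < d} = d := by
  rcases eq_top_or_lt_top d with rfl | hd
  · have : {s : ℝ | 0 < s ∧ ENNReal.ofReal s < ∞} = Ioi 0 := by ext; simp
    rw [this, Real.volume_Ioi]
  · have : {s : ℝ | 0 < s ∧ ENNReal.ofReal s < d} = Ioo 0 d.toReal := by
      ext s
      simp only [mem_ofPred_eq, mem_Ioo]
      refine and_congr_right fun hs => ?_
      rw [ENNReal.ofReal_lt_iff_lt_toReal hs.le hd.ne]
    rw [this, Real.volume_Ioo, sub_zero, ENNReal.ofReal_toReal hd.ne]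

theorem volume_lt_cutRearr (g : α → ℝ≥0∞) (u : ℝ≥0∞) :
    volume {s : ℝ | u < cutRearr μ g s} = μ {x | u < g x} := by
  simp_rw [lt_cutRearr_iff]
  exact volume_setOf_pos_and_ofReal_lt _

end DistRearr

namespace RIQB

variable (X : RIQB)

theorem N_mono_ae {g h : ℝ → ℝ≥0∞} (hg : AEMeasurable g volume) (hh : AEMeasurable h volume)
    (H : g ≤ᵐ[volume] h) : X.N g ≤ X.N h :=
  X.rearr_mono h g hh hg fun s _ => distRearr_mono_ae H s

theorem N_mono {g h : ℝ → ℝ≥0∞} (hg : AEMeasurable g volume) (hh : AEMeasurable h volume)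
    (H : ∀ x, g x ≤ h x) : X.N g ≤ X.N h :=
  X.N_mono_ae hg hh (Eventually.of_forall H)

theorem N_congr_distrib {g h : ℝ → ℝ≥0∞} (hg : AEMeasurable g volume)
    (hh : AEMeasurable h volume)
    (H : ∀ u, volume {x | u < g x} = volume {x | u < h x}) : X.N g = X.N h :=
  le_antisymm (X.rearr_mono _ _ hh hg fun s _ => distRearr_le_distRearr (fun u => (H u).le) s)
    (X.rearr_mono _ _ hg hh fun s _ => distRearr_le_distRearr (fun u => (H u).ge) s)

theorem N_cutRearr {g : ℝ → ℝ≥0∞} (hg : AEMeasurable g volume) :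
    X.N (cutRearr volume g) = X.N g :=
  X.N_congr_distrib (measurable_cutRearr g).aemeasurable hg fun u => volume_lt_cutRearr g u

theorem ae_lt_top {g : ℝ → ℝ≥0∞} (hg : AEMeasurable g volume) (h : X.N g < ∞) :
    ∀ᵐ x, g x < ∞ := by
  set k : ℝ → ℝ≥0∞ := fun x => if hg.mk g x = ∞ then 1 else 0 with hk
  have hkm : Measurable k := Measurable.ite (hg.measurable_mk (measurableSet_singleton ∞))
    measurable_const measurable_const
  have hle : X.N (fun x => ∞ * k x) ≤ X.N g := by
    refine X.N_mono_ae (hkm.const_mul _).aemeasurable hg ?_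
    filter_upwards [hg.ae_eq_mk] with x hx
    by_cases hx' : hg.mk g x = ∞
    · simp [hx, hx']
    · simp [hk, hx']
  rw [X.norm_smul] at hle
  have h0 : X.N k = 0 := by
    by_contra h0
    rw [ENNReal.top_mul h0] at hle
    exact (lt_of_le_of_lt hle h).ne rfl
  have hk0 := (X.definite k hkm.aemeasurable).1 h0
  filter_upwards [hk0, hg.ae_eq_mk] with x hx hx'
  rw [hx', lt_top_iff_ne_top]
  intro htop
  simp [hk, htop] at hx

theorem cutRearr_lt_top {α : Type*} [MeasurableSpace α] {μ : Measure α} {g : α → ℝ≥0∞}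
    (h : X.N (cutRearr μ g) < ∞) (s : ℝ) : cutRearr μ g s < ∞ := by
  by_cases hs : 0 < s
  · have hae := X.ae_lt_top (measurable_cutRearr g).aemeasurable h
    have : ∃ r ∈ Ioo 0 s, cutRearr μ g r < ∞ := by
      by_contra! hcon
      have h1 : volume (Ioo 0 s) = 0 := measure_mono_null
        (fun r hr => not_lt.2 (hcon r hr)) hae
      rw [Real.volume_Ioo, ENNReal.ofReal_eq_zero] at h1
      linarith
    obtain ⟨r, hr, hr'⟩ := this
    rw [cutRearr_of_pos hr.1] at hr'
    rw [cutRearr_of_pos hs]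
    exact lt_of_le_of_lt (distRearr_antitone g hr.2.le) hr'
  · simp [cutRearr_of_nonpos (not_lt.1 hs)]

end RIQB

namespace RIQB

variable (X : RIQB)

theorem N_zero : X.N (fun _ => 0) = 0 :=
  (X.definite _ measurable_const.aemeasurable).2 (Eventually.of_forall fun _ => rfl)

theorem two_mul_ofReal_C_mul_inv : 2 * ENNReal.ofReal X.C * (2 * ENNReal.ofReal X.C)⁻¹ = 1 := by
  have hC : 0 < X.C := lt_of_lt_of_le one_pos X.one_le_C
  refine ENNReal.mul_inv_cancel ?_ (ENNReal.mul_ne_top (by simp) ENNReal.ofReal_ne_top)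
  exact mul_ne_zero (by simp) (ENNReal.ofReal_pos.2 hC).ne'

/-- Partial sums of a series whose quasi-norms decay geometrically, with ratio small compared to
the constant in the quasi-triangle inequality. -/
theorem N_sum_le {g : ℕ → ℝ → ℝ≥0∞} (hg : ∀ j, Measurable (g j)) {K : ℝ≥0∞}
    (hN : ∀ j, X.N (g j) ≤ K * (2 * ENNReal.ofReal X.C)⁻¹ ^ j) (m i : ℕ) :
    X.N (fun x => ∑ j ∈ Finset.range m, g (i + j) x) ≤
      2 * ENNReal.ofReal X.C * K * (2 * ENNReal.ofReal X.C)⁻¹ ^ i := by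
  induction m generalizing i with
  | zero => simp [X.N_zero]
  | succ m ih =>
    have hsum : (fun x => ∑ j ∈ Finset.range (m + 1), g (i + j) x) =
        fun x => g i x + ∑ j ∈ Finset.range m, g (i + 1 + j) x := by
      funext x
      rw [Finset.sum_range_succ', add_comm, add_zero]
      simp_rw [add_assoc, add_comm 1]
    rw [hsum]
    refine (X.quasi_triangle _ _ (hg i).aemeasurable
      (Finset.measurable_fun_sum _ fun j _ => hg _).aemeasurable).trans ?_
    refine (mul_le_mul_right (add_le_add (hN i) (ih (i + 1))) _).trans ?_
    have h := X.two_mul_ofReal_C_mul_inv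
    set c := ENNReal.ofReal X.C
    set r := (2 * c)⁻¹
    calc c * (K * r ^ i + 2 * c * K * r ^ (i + 1))
        = c * (K * r ^ i + 2 * c * r * (K * r ^ i)) := by ring
      _ = 2 * c * K * r ^ i := by rw [h]; ring
      _ ≤ _ := le_rfl

theorem N_tsum_le {g : ℕ → ℝ → ℝ≥0∞} (hg : ∀ j, Measurable (g j)) (hfin : ∀ j x, g j x < ∞)
    {K : ℝ≥0∞} (hK : K < ∞) (hN : ∀ j, X.N (g j) ≤ K * (2 * ENNReal.ofReal X.C)⁻¹ ^ j) :
    X.N (fun x => ∑' j, g j x) ≤ 2 * ENNReal.ofReal X.C ^ 2 * K := by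
  set c := ENNReal.ofReal X.C with hc
  have hctop : c ≠ ∞ := ENNReal.ofReal_ne_top
  have hc1 : 1 ≤ c := by simpa [hc] using X.one_le_C
  set r := (2 * c)⁻¹ with hr
  have hr1 : r < 1 := by
    rw [hr, ENNReal.inv_lt_one]
    calc (1 : ℝ≥0∞) < 2 := by norm_num
      _ = 2 * 1 := by norm_num
      _ ≤ 2 * c := by gcongr
  have hKtop : 2 * c * K ≠ ∞ :=
    ENNReal.mul_ne_top (ENNReal.mul_ne_top (by simp) hctop) hK.ne
  have hpart := fun m i => X.N_sum_le hg hN m i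
  set S : ℕ → ℝ → ℝ≥0∞ := fun m x => ∑ j ∈ Finset.range m, g j x with hS
  have hSm : ∀ m, Measurable (S m) := fun m => Finset.measurable_fun_sum _ fun j _ => hg _
  have hSfin : ∀ m x, S m x ≠ ∞ := fun m x => (ENNReal.sum_lt_top.2 fun j _ => hfin j x).ne
  have hSN : ∀ m, X.N (S m) ≤ 2 * c * K := fun m => by simpa using hpart m 0
  have hSmono : ∀ x, Monotone fun m => S m x := fun x m n hmn =>
    Finset.sum_le_sum_of_subset (Finset.range_mono hmn)
  have hdiff : ∀ m n, m ≤ n → X.N (fun x => S n x - S m x) ≤ 2 * c * K * r ^ m := by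
    intro m n hmn
    obtain ⟨k, rfl⟩ := Nat.exists_eq_add_of_le hmn
    convert hpart k m using 2
    funext x
    simp only [hS]
    rw [Finset.sum_range_add]
    exact ENNReal.add_sub_cancel_left (hSfin m x)
  set f : ℕ → ℝ → ℝ := fun m x => (S m x).toReal with hf
  have hfS : ∀ m x, ENNReal.ofReal |f m x| = S m x := fun m x => by
    rw [abs_of_nonneg ENNReal.toReal_nonneg, ENNReal.ofReal_toReal (hSfin m x)]
  have hfm : ∀ m, Measurable (f m) := fun m => (hSm m).ennreal_toReal
  have hfdiff : ∀ m n, m ≤ n → ∀ x, ENNReal.ofReal |f n x - f m x| = S n x - S m x := by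
    intro m n hmn x
    rw [abs_of_nonneg (sub_nonneg.2 (ENNReal.toReal_mono (hSfin n x) (hSmono x hmn))),
      ENNReal.ofReal_sub _ ENNReal.toReal_nonneg, ENNReal.ofReal_toReal (hSfin n x),
      ENNReal.ofReal_toReal (hSfin m x)]
  have hlim : Tendsto (fun m => 2 * c * K * r ^ m) atTop (𝓝 0) := by
    have := ENNReal.Tendsto.const_mul (ENNReal.tendsto_pow_atTop_nhds_zero_of_lt_one hr1)
      (Or.inr hKtop)
    simpa using this
  obtain ⟨G, hGm, -, hGlim⟩ := X.complete f
    (fun n => ⟨(hfm n).aemeasurable, by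
      simp_rw [hfS]; exact lt_of_le_of_lt (hSN n) hKtop.lt_top⟩)
    (by
      intro ε hε
      obtain ⟨M, hM⟩ := eventually_atTop.1
        ((tendsto_order.1 hlim).2 (ENNReal.ofReal ε) (ENNReal.ofReal_pos.2 hε))
      have key : ∀ m ≥ M, ∀ n ≥ m,
          X.N (fun x => ENNReal.ofReal |f n x - f m x|) < ENNReal.ofReal ε := by
        intro m hm n hn
        simp_rw [hfdiff m n hn]
        exact lt_of_le_of_lt (hdiff m n hn) (hM m hm)
      refine ⟨M, fun m hm n hn => ?_⟩
      rcases le_total m n with h | h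
      · simp_rw [abs_sub_comm (f m _)]
        exact key m hm n h
      · exact key n hn m h)
  have hGm' : AEMeasurable (fun x => ENNReal.ofReal |G x|) volume := hGm.abs.ennreal_ofReal
  have hdm : ∀ n, AEMeasurable (fun x => ENNReal.ofReal |f n x - G x|) volume := fun n =>
    ((hfm n).aemeasurable.sub hGm).abs.ennreal_ofReal
  have hle : ∀ m, ∀ᵐ x, S m x ≤ ENNReal.ofReal |G x| := by
    intro m
    have h0 : X.N (fun x => S m x - ENNReal.ofReal |G x|) = 0 := by
      refine le_antisymm (ge_of_tendsto hGlim ?_) bot_le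
      filter_upwards [eventually_ge_atTop m] with n hn
      refine X.N_mono ((hSm m).aemeasurable.sub hGm') (hdm n) fun x => ?_
      refine tsub_le_iff_right.2 ((hSmono x hn).trans ?_)
      dsimp only
      rw [← hfS, ← ENNReal.ofReal_add (abs_nonneg _) (abs_nonneg _)]
      refine ENNReal.ofReal_le_ofReal ?_
      calc |f n x| = |f n x - G x + G x| := by ring_nf
        _ ≤ _ := abs_add_le _ _
    have := (X.definite _ ((hSm m).aemeasurable.sub hGm')).1 h0
    filter_upwards [this] with x hx
    simpa [tsub_eq_zero_iff_le] using hx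
  have hle' : ∀ᵐ x, ∑' j, g j x ≤ ENNReal.ofReal |G x| := by
    filter_upwards [ae_all_iff.2 hle] with x hx
    exact ENNReal.tsum_le_of_sum_range_le hx
  refine (X.N_mono_ae (Measurable.tsum hg).aemeasurable hGm' hle').trans ?_
  have hbound : ∀ n, X.N (fun x => ENNReal.ofReal |G x|) ≤
      c * (X.N (fun x => ENNReal.ofReal |f n x - G x|) + 2 * c * K) := by
    intro n
    refine (X.N_mono (h := fun x => ENNReal.ofReal |f n x - G x| + S n x) hGm'
      ((hdm n).add (hSm n).aemeasurable) fun x => ?_).trans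
      ((X.quasi_triangle _ _ (hdm n) (hSm n).aemeasurable).trans ?_)
    · rw [← hfS, ← ENNReal.ofReal_add (abs_nonneg _) (abs_nonneg _)]
      refine ENNReal.ofReal_le_ofReal ?_
      calc |G x| = |-(f n x - G x) + f n x| := by ring_nf
        _ ≤ _ := (abs_add_le _ _).trans (by rw [abs_neg])
    · gcongr
      exact hSN n
  have hlim2 := ENNReal.Tendsto.const_mul (hGlim.add_const (2 * c * K)) (a := c)
    (Or.inr hctop)
  refine (ge_of_tendsto' hlim2 hbound).trans (le_of_eq ?_)
  ring

end RIQB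

section Maximal

variable {n : ℕ}

/-- The Hardy-Littlewood maximal function of an `ℝ≥0∞`-valued function. -/
def maximalE (g : EuclideanSpace ℝ (Fin n) → ℝ≥0∞) (x : EuclideanSpace ℝ (Fin n)) : ℝ≥0∞ :=
  ⨆ (R : ℝ) (_ : 0 < R), (volume (Metric.ball x R))⁻¹ * ∫⁻ y in Metric.ball x R, g y

theorem maximalFn_eq_maximalE (f : EuclideanSpace ℝ (Fin n) → ℝ) :
    maximalFn f = maximalE fun x => ENNReal.ofReal |f x| := rfl

theorem volume_ball_eq (x : EuclideanSpace ℝ (Fin n)) {R : ℝ} (hR : 0 < R) :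
    volume (Metric.ball x R) = ENNReal.ofReal (R ^ n) *
      volume (Metric.ball (0 : EuclideanSpace ℝ (Fin n)) 1) := by
  rw [Measure.addHaar_ball_of_pos _ _ hR, finrank_euclideanSpace_fin]

theorem volume_closedBall_eq (x : EuclideanSpace ℝ (Fin n)) {R : ℝ} (hR : 0 ≤ R) :
    volume (Metric.closedBall x R) = ENNReal.ofReal (R ^ n) *
      volume (Metric.ball (0 : EuclideanSpace ℝ (Fin n)) 1) := by
  rw [Measure.addHaar_closedBall _ _ hR, finrank_euclideanSpace_fin]

theorem volume_ball_ne_zero (x : EuclideanSpace ℝ (Fin n)) {R : ℝ} (hR : 0 < R) :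
    volume (Metric.ball x R) ≠ 0 := (Metric.measure_ball_pos _ _ hR).ne'

/-- The weak type `(1,1)` inequality for the maximal function. -/
theorem volume_lt_maximalE_le (hn : 0 < n) {g : EuclideanSpace ℝ (Fin n) → ℝ≥0∞}
    (hg : ∫⁻ x, g x ≠ ∞) {v : ℝ≥0∞} (hv : v ≠ 0) (hv' : v ≠ ∞) :
    volume {x | v < maximalE g x} ≤ 5 ^ n * (v⁻¹ * ∫⁻ x, g x) := by
  set A := {x | v < maximalE g x} with hA
  set ω := volume (Metric.ball (0 : EuclideanSpace ℝ (Fin n)) 1) with hω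
  have hω0 : ω ≠ 0 := volume_ball_ne_zero _ one_pos
  have hωt : ω ≠ ∞ := measure_ball_lt_top.ne
  have hex : ∀ x : A, ∃ R : ℝ, 0 < R ∧
      volume (Metric.ball x.1 R) ≤ v⁻¹ * ∫⁻ y in Metric.ball x.1 R, g y := by
    rintro ⟨x, hx⟩
    obtain ⟨R, hx⟩ := lt_iSup_iff.1 (show v < maximalE g x from hx)
    obtain ⟨hR, hx⟩ := lt_iSup_iff.1 hx
    refine ⟨R, hR, ?_⟩
    have h0 := volume_ball_ne_zero x hR
    have ht : volume (Metric.ball x R) ≠ ∞ := measure_ball_lt_top.ne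
    rw [← ENNReal.div_eq_inv_mul, ENNReal.lt_div_iff_mul_lt (Or.inl h0) (Or.inl ht)] at hx
    rw [← ENNReal.div_eq_inv_mul, ENNReal.le_div_iff_mul_le (Or.inl hv) (Or.inl hv'), mul_comm]
    exact hx.le
  choose r hr hrle using hex
  set W := v⁻¹ * ∫⁻ y, g y with hW
  have hWt : W ≠ ∞ := ENNReal.mul_ne_top (ENNReal.inv_ne_top.2 hv) hg
  have hbdd : ∀ x : A, r x ≤ max 1 (W / ω).toReal := by
    intro x
    rcases le_or_gt (r x) 1 with h1 | h1
    · exact h1.trans (le_max_left _ _)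
    refine le_trans ?_ (le_max_right _ _)
    have h2 : ENNReal.ofReal (r x ^ n) ≤ W / ω := by
      rw [ENNReal.le_div_iff_mul_le (Or.inl hω0) (Or.inl hωt), ← volume_ball_eq x.1 (hr x)]
      exact (hrle x).trans (mul_le_mul_right (setLIntegral_le_lintegral _ _) _)
    calc r x ≤ r x ^ n := le_self_pow₀ h1.le hn.ne'
      _ ≤ (W / ω).toReal := (ENNReal.ofReal_le_iff_le_toReal
          (ENNReal.div_ne_top hWt hω0)).1 h2
  obtain ⟨u, -, hdisj, hcov⟩ := Vitali.exists_disjoint_subfamily_covering_enlargement_closedBall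
    (univ : Set A) (fun x => x.1) r _ (fun x _ => hbdd x) 5 (by norm_num)
  have hcount : u.Countable := hdisj.countable_of_nonempty_interior fun x _ =>
    ⟨x.1, Metric.ball_subset_interior_closedBall (Metric.mem_ball_self (hr x))⟩
  have hsub : A ⊆ ⋃ b ∈ u, Metric.closedBall b.1 (5 * r b) := by
    intro x hx
    obtain ⟨b, hb, hb'⟩ := hcov ⟨x, hx⟩ (mem_univ _)
    exact mem_biUnion hb (hb' (Metric.mem_closedBall_self (hr _).le))
  have hdisj' : u.PairwiseDisjoint fun x => Metric.ball x.1 (r x) :=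
    hdisj.mono fun x => Metric.ball_subset_closedBall
  calc volume A ≤ volume (⋃ b ∈ u, Metric.closedBall b.1 (5 * r b)) := measure_mono hsub
    _ ≤ ∑' b : u, volume (Metric.closedBall b.1.1 (5 * r b)) := measure_biUnion_le _ hcount _
    _ ≤ ∑' b : u, 5 ^ n * (v⁻¹ * ∫⁻ y in Metric.ball b.1.1 (r b), g y) := by
        refine ENNReal.tsum_le_tsum fun b => ?_
        have h5 : ENNReal.ofReal (5 ^ n) = 5 ^ n := by
          rw [ENNReal.ofReal_pow (by norm_num)]; norm_num
        rw [volume_closedBall_eq _ (mul_nonneg (by norm_num) (hr b).le), mul_pow,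
          ENNReal.ofReal_mul (by positivity), mul_assoc, ← volume_ball_eq b.1.1 (hr b), h5]
        exact mul_le_mul_right (hrle b) _
    _ = 5 ^ n * (v⁻¹ * ∑' b : u, ∫⁻ y in Metric.ball b.1.1 (r b), g y) := by
        rw [ENNReal.tsum_mul_left, ENNReal.tsum_mul_left]
    _ = 5 ^ n * (v⁻¹ * ∫⁻ y in ⋃ b ∈ u, Metric.ball b.1 (r b), g y) := by
        rw [lintegral_biUnion hcount (fun _ _ => measurableSet_ball) hdisj']
    _ ≤ _ := mul_le_mul_right (mul_le_mul_right (setLIntegral_le_lintegral _ _) _) _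

theorem maximalE_le_add {g h : EuclideanSpace ℝ (Fin n) → ℝ≥0∞} {u : ℝ≥0∞}
    (H : ∀ x, g x ≤ u + h x) (x : EuclideanSpace ℝ (Fin n)) :
    maximalE g x ≤ u + maximalE h x := by
  refine iSup₂_le fun R hR => ?_
  have h0 := volume_ball_ne_zero x hR
  have ht : volume (Metric.ball x R) ≠ ∞ := measure_ball_lt_top.ne
  calc (volume (Metric.ball x R))⁻¹ * ∫⁻ y in Metric.ball x R, g y
      ≤ (volume (Metric.ball x R))⁻¹ * ∫⁻ y in Metric.ball x R, (u + h y) := by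
        gcongr with y; exact H y
    _ = u + (volume (Metric.ball x R))⁻¹ * ∫⁻ y in Metric.ball x R, h y := by
        rw [lintegral_add_left measurable_const, setLIntegral_const, mul_add, mul_left_comm,
          ENNReal.inv_mul_cancel h0 ht, mul_one]
    _ ≤ _ := by
        gcongr
        exact le_iSup₂ (f := fun (R : ℝ) (_ : 0 < R) =>
          (volume (Metric.ball x R))⁻¹ * ∫⁻ y in Metric.ball x R, h y) R hR

/-- The Hardy averaging operator. -/
def hardyAvg (k : ℝ → ℝ≥0∞) (t : ℝ) : ℝ≥0∞ :=
  if 0 < t then ENNReal.ofReal t⁻¹ * ∫⁻ s in Ioo 0 t, k s else 0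

theorem measurable_hardyAvg (k : ℝ → ℝ≥0∞) : Measurable (hardyAvg k) := by
  have hmono : Monotone fun t : ℝ => ∫⁻ s in Ioo 0 t, k s := fun a b hab =>
    lintegral_mono_set (Ioo_subset_Ioo_right hab)
  exact Measurable.ite measurableSet_Ioi
    (measurable_inv.ennreal_ofReal.mul hmono.measurable) measurable_const

/-- The integral of the part of `f` above level `f^*(t)` is at most `∫₀ᵗ f^*`. -/
theorem lintegral_above_distRearr_le {α : Type*} [MeasurableSpace α] {μ : Measure α} {f : α → ℝ}
    (hf : AEMeasurable f μ) {t : ℝ}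
    (hfin : ∀ s, cutRearr μ (fun x => ENNReal.ofReal |f x|) s < ∞) :
    ∫⁻ x, {x | distRearr μ (fun x => ENNReal.ofReal |f x|) t < ENNReal.ofReal |f x|}.indicator
        (fun x => ENNReal.ofReal |f x|) x ∂μ ≤
      ∫⁻ s in Ioo 0 t, cutRearr μ (fun x => ENNReal.ofReal |f x|) s := by
  set g : α → ℝ≥0∞ := fun x => ENNReal.ofReal |f x| with hg
  set lam := distRearr μ g t with hlam
  have hgm : AEMeasurable g μ := hf.abs.ennreal_ofReal
  have hA : NullMeasurableSet {x | lam < g x} μ := nullMeasurableSet_lt aemeasurable_const hgm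
  have hlam_le : μ {x | lam < g x} ≤ ENNReal.ofReal t := by
    by_contra! h
    exact lt_irrefl _ (lt_distRearr_iff.2 h)
  set h : α → ℝ := {x | lam < g x}.indicator fun x => |f x| with hh
  have hhm : AEMeasurable h μ := hf.abs.indicator₀ hA
  have e1 : ∀ x, {x | lam < g x}.indicator g x = ENNReal.ofReal (h x) := by
    intro x
    by_cases hx : x ∈ {x | lam < g x}
    · rw [hh, indicator_of_mem hx, indicator_of_mem hx]
    · rw [hh, indicator_of_notMem hx, indicator_of_notMem hx, ENNReal.ofReal_zero]
  have e2 : ∀ s, cutRearr μ g s = ENNReal.ofReal (cutRearr μ g s).toReal := fun s =>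
    (ENNReal.ofReal_toReal (hfin s).ne).symm
  change ∫⁻ x, {x | lam < g x}.indicator g x ∂μ ≤ _
  rw [lintegral_congr e1, lintegral_congr e2, lintegral_eq_lintegral_meas_lt μ
    (Eventually.of_forall fun x => indicator_nonneg (fun _ _ => abs_nonneg _) x) hhm,
    lintegral_eq_lintegral_meas_lt _ (Eventually.of_forall fun x => ENNReal.toReal_nonneg)
      (measurable_cutRearr g).ennreal_toReal.aemeasurable]
  refine setLIntegral_mono' measurableSet_Ioi fun u hu => ?_
  have hu0 : 0 ≤ u := (mem_Ioi.1 hu).le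
  have hsub : {x | u < h x} ⊆ {x | lam < g x} ∩ {x | ENNReal.ofReal u < g x} := by
    intro x hx
    by_cases hx' : x ∈ {x | lam < g x}
    · refine ⟨hx', ?_⟩
      have hx2 : u < |f x| := by simpa only [hh, mem_ofPred_eq, indicator_of_mem hx'] using hx
      exact (ENNReal.ofReal_lt_ofReal_iff (hu0.trans_lt hx2)).2 hx2
    · have hx2 : u < 0 := by simpa only [hh, mem_ofPred_eq, indicator_of_notMem hx'] using hx
      exact absurd hx2 hu0.not_gt
  have hset : {s : ℝ | u < (cutRearr μ g s).toReal} =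
      {s : ℝ | 0 < s ∧ ENNReal.ofReal s < μ {x | ENNReal.ofReal u < g x}} := by
    ext s
    simp only [mem_ofPred_eq]
    rw [← lt_cutRearr_iff, ENNReal.ofReal_lt_iff_lt_toReal hu0 (hfin s).ne]
  rw [hset, Measure.restrict_apply' measurableSet_Ioo]
  have hset2 : {s : ℝ | 0 < s ∧ ENNReal.ofReal s < μ {x | ENNReal.ofReal u < g x}} ∩ Ioo 0 t =
      {s : ℝ | 0 < s ∧ ENNReal.ofReal s <
        min (μ {x | ENNReal.ofReal u < g x}) (ENNReal.ofReal t)} := by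
    ext s
    simp only [mem_inter_iff, mem_ofPred_eq, mem_Ioo, lt_min_iff]
    constructor
    · rintro ⟨⟨h1, h2⟩, h3, h4⟩
      exact ⟨h1, h2, (ENNReal.ofReal_lt_ofReal_iff (h1.trans h4)).2 h4⟩
    · rintro ⟨h1, h2, h3⟩
      exact ⟨⟨h1, h2⟩, h1, (ENNReal.ofReal_lt_ofReal_iff_of_nonneg h1.le).1 h3⟩
  rw [hset2, volume_setOf_pos_and_ofReal_lt]
  exact le_min (measure_mono (hsub.trans inter_subset_right))
    ((measure_mono (hsub.trans inter_subset_left)).trans hlam_le)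

/-- The upper Herz inequality `(Mf)^* ≤ c f^{**}`. -/
theorem distRearr_maximalFn_le (hn : 0 < n) {f : EuclideanSpace ℝ (Fin n) → ℝ}
    (hf : AEMeasurable f volume)
    (hfin : ∀ s, cutRearr volume (fun x => ENNReal.ofReal |f x|) s < ∞) {t : ℝ} (ht : 0 < t) :
    distRearr volume (maximalFn f) t ≤
      (1 + 5 ^ n) * hardyAvg (cutRearr volume (fun x => ENNReal.ofReal |f x|)) t := by
  set g : EuclideanSpace ℝ (Fin n) → ℝ≥0∞ := fun x => ENNReal.ofReal |f x| with hg
  set I := ∫⁻ s in Ioo 0 t, cutRearr volume g s with hI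
  have hH : hardyAvg (cutRearr volume g) t = ENNReal.ofReal t⁻¹ * I := if_pos ht
  rw [hH, maximalFn_eq_maximalE]
  rcases eq_top_or_lt_top I with hItop | hIt
  · rw [hItop, ENNReal.mul_top (ENNReal.ofReal_pos.2 (inv_pos.2 ht)).ne', ENNReal.mul_top (by simp)]
    exact le_top
  set lam := distRearr volume g t with hlam
  have htinv : ENNReal.ofReal t⁻¹ * ENNReal.ofReal t = 1 := by
    rw [← ENNReal.ofReal_mul (inv_pos.2 ht).le, inv_mul_cancel₀ ht.ne', ENNReal.ofReal_one]
  have hlamI : lam ≤ ENNReal.ofReal t⁻¹ * I := by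
    have : lam * ENNReal.ofReal t ≤ I := by
      calc lam * ENNReal.ofReal t = ∫⁻ _ in Ioo 0 t, lam := by
            rw [setLIntegral_const, Real.volume_Ioo, sub_zero]
        _ ≤ I := setLIntegral_mono' measurableSet_Ioo fun s hs => by
            rw [cutRearr_of_pos hs.1]
            exact distRearr_antitone g hs.2.le
    calc lam = ENNReal.ofReal t⁻¹ * (lam * ENNReal.ofReal t) := by
          rw [mul_left_comm, htinv, mul_one]
      _ ≤ _ := by gcongr
  set h : EuclideanSpace ℝ (Fin n) → ℝ≥0∞ := {x | lam < g x}.indicator g with hh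
  have hhI : ∫⁻ x, h x ≤ I := lintegral_above_distRearr_le hf hfin
  have hMle : ∀ x, maximalE g x ≤ lam + maximalE h x := by
    refine maximalE_le_add fun x => ?_
    by_cases hx : x ∈ {x | lam < g x}
    · rw [hh, indicator_of_mem hx]; exact le_add_self
    · exact (not_lt.1 hx).trans le_self_add
  have key : ∀ v, 5 ^ n * (ENNReal.ofReal t⁻¹ * I) < v →
      distRearr volume (maximalE g) t ≤ lam + v := by
    intro v hv
    rcases eq_top_or_lt_top v with rfl | hvt
    · simp
    have hv0 : v ≠ 0 := (bot_le.trans_lt hv).ne'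
    by_contra! hcon
    rw [lt_distRearr_iff] at hcon
    have hsub : {x | lam + v < maximalE g x} ⊆ {x | v < maximalE h x} := by
      intro x hx
      have h1 := lt_of_lt_of_le hx (hMle x)
      by_contra h2
      exact absurd h1 (not_lt.2 (by gcongr; exact not_lt.1 h2))
    have h1 := hcon.trans_le ((measure_mono hsub).trans
      (volume_lt_maximalE_le hn (hhI.trans_lt hIt).ne hv0 hvt.ne))
    have h2 : v * ENNReal.ofReal t ≤ 5 ^ n * I := by
      calc v * ENNReal.ofReal t ≤ v * (5 ^ n * (v⁻¹ * I)) := by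
            gcongr; exact h1.le.trans (by gcongr)
        _ = v * v⁻¹ * (5 ^ n * I) := by ring
        _ = 5 ^ n * I := by rw [ENNReal.mul_inv_cancel hv0 hvt.ne, one_mul]
    have h3 : v ≤ 5 ^ n * (ENNReal.ofReal t⁻¹ * I) := by
      calc v = ENNReal.ofReal t⁻¹ * (v * ENNReal.ofReal t) := by
            rw [mul_left_comm, htinv, mul_one]
        _ ≤ ENNReal.ofReal t⁻¹ * (5 ^ n * I) := by gcongr
        _ = _ := by ring
    exact absurd hv h3.not_gt
  rw [add_mul, one_mul]
  rcases eq_or_ne (distRearr volume (maximalE g) t) ∞ with htop | htop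
  · have hne : 5 ^ n * (ENNReal.ofReal t⁻¹ * I) ≠ ∞ := by finiteness
    obtain ⟨v, hv1, hv2⟩ := exists_between hne.lt_top
    have := key v hv1
    rw [htop, top_le_iff, ENNReal.add_eq_top] at this
    rcases this with h | h
    · rw [h, top_le_iff] at hlamI; rw [hlamI]; simp
    · exact absurd h hv2.ne
  refine le_trans ?_ (add_le_add_left hlamI _)
  refine le_of_forall_gt_imp_ge_of_dense fun w hw => ?_
  have hlamw : lam ≤ w := le_self_add.trans hw.le
  have : w = lam + (w - lam) := (add_tsub_cancel_of_le hlamw).symm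
  rw [this]
  exact key _ (lt_tsub_iff_left.2 hw)

end Maximal

theorem hardyAvg_le_tsum {α : Type*} [MeasurableSpace α] {μ : Measure α} (g : α → ℝ≥0∞) {b : ℝ}
    (hb0 : 0 < b) (hb1 : b < 1) (t : ℝ) :
    hardyAvg (cutRearr μ g) t ≤
      ∑' j : ℕ, ENNReal.ofReal (b ^ j) * cutRearr μ g (b ^ (j + 1) * t) := by
  by_cases ht : 0 < t
  swap
  · simp [hardyAvg, ht]
  have hcov : Ioo 0 t ⊆ ⋃ j : ℕ, Ioc (b ^ (j + 1) * t) (b ^ j * t) := by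
    intro s hs
    obtain ⟨j, hj1, hj2⟩ := exists_nat_pow_near_of_lt_one (div_pos hs.1 ht)
      ((div_le_one ht).2 hs.2.le) hb0 hb1
    exact mem_iUnion.2 ⟨j, (lt_div_iff₀ ht).1 hj1, (div_le_iff₀ ht).1 hj2⟩
  have hterm : ∀ j : ℕ, ∫⁻ s in Ioc (b ^ (j + 1) * t) (b ^ j * t), cutRearr μ g s ≤
      ENNReal.ofReal t * (ENNReal.ofReal (b ^ j) * cutRearr μ g (b ^ (j + 1) * t)) := by
    intro j
    have hpos : 0 < b ^ (j + 1) * t := by positivity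
    calc ∫⁻ s in Ioc (b ^ (j + 1) * t) (b ^ j * t), cutRearr μ g s
        ≤ ∫⁻ _ in Ioc (b ^ (j + 1) * t) (b ^ j * t), cutRearr μ g (b ^ (j + 1) * t) :=
          setLIntegral_mono' measurableSet_Ioc fun s hs => by
            rw [cutRearr_of_pos hpos, cutRearr_of_pos (hpos.trans hs.1)]
            exact distRearr_antitone g hs.1.le
      _ = cutRearr μ g (b ^ (j + 1) * t) * ENNReal.ofReal (b ^ j * t - b ^ (j + 1) * t) := by
          rw [setLIntegral_const, Real.volume_Ioc]
      _ ≤ cutRearr μ g (b ^ (j + 1) * t) * ENNReal.ofReal (b ^ j * t) := by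
          gcongr; linarith
      _ = _ := by rw [ENNReal.ofReal_mul (by positivity)]; ring
  rw [hardyAvg, if_pos ht]
  calc ENNReal.ofReal t⁻¹ * ∫⁻ s in Ioo 0 t, cutRearr μ g s
      ≤ ENNReal.ofReal t⁻¹ *
        ∑' j : ℕ, ∫⁻ s in Ioc (b ^ (j + 1) * t) (b ^ j * t), cutRearr μ g s := by
        gcongr
        exact (lintegral_mono_set hcov).trans (lintegral_iUnion_le _ _)
    _ ≤ ENNReal.ofReal t⁻¹ * ∑' j : ℕ,
        ENNReal.ofReal t * (ENNReal.ofReal (b ^ j) * cutRearr μ g (b ^ (j + 1) * t)) := by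
        gcongr with j; exact hterm j
    _ = _ := by
        rw [ENNReal.tsum_mul_left, ← mul_assoc, ← ENNReal.ofReal_mul (inv_pos.2 ht).le,
          inv_mul_cancel₀ ht.ne', ENNReal.ofReal_one, one_mul]

/-- If dilations grow at rate `a ^ (-1/p)` with `p > 1`, then the Hardy averaging operator is
bounded on rearrangements. -/
theorem RIQB.exists_N_hardyAvg_le (X : RIQB) {p c : ℝ} (hp : 1 < p) (hc : 0 < c)
    (H : ∀ a : ℝ, 0 < a → a < 1 → ∀ f : ℝ → ℝ, AEMeasurable f volume → X.Nr f < ∞ →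
      X.Nr (dil a f) ≤ ENNReal.ofReal (c * a ^ (-(1 / p))) * X.Nr f) :
    ∃ A : ℝ, 0 < A ∧ ∀ {α : Type} [MeasurableSpace α] (μ : Measure α) (g : α → ℝ≥0∞),
      X.N (cutRearr μ g) < ∞ →
        X.N (hardyAvg (cutRearr μ g)) ≤ ENNReal.ofReal A * X.N (cutRearr μ g) := by
  have hC : 0 < X.C := lt_of_lt_of_le one_pos X.one_le_C
  set θ : ℝ := 1 - 1 / p with hθ
  have hθ0 : 0 < θ := by
    rw [hθ, sub_pos, div_lt_one (one_pos.trans hp)]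
    exact hp
  set b : ℝ := ((2 * X.C)⁻¹) ^ (1 / θ) with hb
  have hr0 : 0 < (2 * X.C)⁻¹ := by positivity
  have hr1 : (2 * X.C)⁻¹ < 1 := inv_lt_one_of_one_lt₀ (by linarith [X.one_le_C])
  have hb0 : 0 < b := Real.rpow_pos_of_pos hr0 _
  have hb1 : b < 1 := Real.rpow_lt_one hr0.le hr1 (by positivity)
  have hbθ : b ^ θ = (2 * X.C)⁻¹ := by
    rw [hb, ← Real.rpow_mul hr0.le, one_div_mul_cancel hθ0.ne', Real.rpow_one]
  refine ⟨2 * X.C ^ 2 * (c * b ^ (-(1 / p))), by positivity, ?_⟩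
  intro α _ μ g hfin
  set k := cutRearr μ g with hk
  have hkm : Measurable k := measurable_cutRearr g
  have hkt : ∀ s, k s < ∞ := X.cutRearr_lt_top hfin
  have hkr : ∀ s, ENNReal.ofReal |(k s).toReal| = k s := fun s => by
    rw [abs_of_nonneg ENNReal.toReal_nonneg, ENNReal.ofReal_toReal (hkt s).ne]
  have hdil : ∀ a : ℝ, 0 < a → a < 1 →
      X.N (fun s => k (a * s)) ≤ ENNReal.ofReal (c * a ^ (-(1 / p))) * X.N k := by
    intro a ha0 ha1
    have := H a ha0 ha1 (fun s => (k s).toReal) hkm.ennreal_toReal.aemeasurable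
      (by simpa only [RIQB.Nr, hkr] using hfin)
    simpa only [RIQB.Nr, dil, hkr] using this
  have hgm : ∀ j : ℕ, Measurable fun t => ENNReal.ofReal (b ^ j) * k (b ^ (j + 1) * t) :=
    fun j => (hkm.comp (measurable_const_mul _)).const_mul _
  have hreal : ∀ j : ℕ, b ^ j * (c * (b ^ (j + 1)) ^ (-(1 / p))) =
      c * b ^ (-(1 / p)) * ((2 * X.C)⁻¹) ^ j := by
    intro j
    rw [← hbθ, ← Real.rpow_natCast, ← Real.rpow_natCast, ← Real.rpow_natCast,
      ← Real.rpow_mul hb0.le, ← Real.rpow_mul hb0.le, mul_left_comm, mul_assoc,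
      ← Real.rpow_add hb0, ← Real.rpow_add hb0, hθ]
    congr 2
    push_cast
    ring
  have hN : ∀ j : ℕ, X.N (fun t => ENNReal.ofReal (b ^ j) * k (b ^ (j + 1) * t)) ≤
      ENNReal.ofReal (c * b ^ (-(1 / p))) * X.N k * (2 * ENNReal.ofReal X.C)⁻¹ ^ j := by
    intro j
    have hinv : (2 * ENNReal.ofReal X.C)⁻¹ = ENNReal.ofReal (2 * X.C)⁻¹ := by
      rw [ENNReal.ofReal_inv_of_pos (by positivity), ENNReal.ofReal_mul (by norm_num)]
      norm_num
    rw [X.norm_smul]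
    calc ENNReal.ofReal (b ^ j) * X.N (fun t => k (b ^ (j + 1) * t))
        ≤ ENNReal.ofReal (b ^ j) *
          (ENNReal.ofReal (c * (b ^ (j + 1)) ^ (-(1 / p))) * X.N k) := by
          gcongr
          exact hdil _ (by positivity) (pow_lt_one₀ hb0.le hb1 (by omega))
      _ = _ := by
          rw [← mul_assoc, ← ENNReal.ofReal_mul (by positivity), hreal,
            ENNReal.ofReal_mul (by positivity), ENNReal.ofReal_pow hr0.le, hinv]
          ring
  have hsum := X.N_tsum_le hgm (fun j t => ENNReal.mul_lt_top ENNReal.ofReal_lt_top (hkt _))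
    (ENNReal.mul_lt_top ENNReal.ofReal_lt_top hfin) hN
  refine (X.N_mono (measurable_hardyAvg k).aemeasurable (Measurable.tsum hgm).aemeasurable
    fun t => hardyAvg_le_tsum g hb0 hb1 t).trans (hsum.trans (le_of_eq ?_))
  have hC2 : ENNReal.ofReal (2 * X.C ^ 2) = 2 * ENNReal.ofReal X.C ^ 2 := by
    rw [ENNReal.ofReal_mul (by norm_num), ENNReal.ofReal_pow hC.le]
    norm_num
  rw [ENNReal.ofReal_mul (p := 2 * X.C ^ 2) (by positivity), hC2]
  ring

theorem maximal_bounded_of_one_lt_lowerBoyd {n : ℕ} (hn : 0 < n) (X : RIQB)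
    (h : 1 < lowerBoyd X) :
    ∃ c : ℝ, 0 < c ∧ ∀ f : EuclideanSpace ℝ (Fin n) → ℝ, AEMeasurable f volume →
      XnormRn X n (fun x => ENNReal.ofReal |f x|) < ∞ →
        XnormRn X n (maximalFn f) ≤
          ENNReal.ofReal c * XnormRn X n (fun x => ENNReal.ofReal |f x|) := by
  obtain ⟨p, h⟩ := lt_iSup_iff.1 (show 1 < lowerBoydOf X.Nr from h)
  obtain ⟨⟨-, c, hc, H⟩, hp⟩ := lt_iSup_iff.1 h
  obtain ⟨A, hA, hbound⟩ := X.exists_N_hardyAvg_le (ENNReal.one_lt_ofReal.1 hp) hc H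
  refine ⟨(1 + 5 ^ n) * A, by positivity, fun f hf hfin => ?_⟩
  have hfin' : X.N (cutRearr volume fun x => ENNReal.ofReal |f x|) < ∞ := hfin
  have hcast : ENNReal.ofReal (1 + 5 ^ n) = 1 + 5 ^ n := by
    rw [ENNReal.ofReal_add (by norm_num) (by positivity), ENNReal.ofReal_pow (by norm_num)]
    norm_num
  calc X.N (cutRearr volume (maximalFn f))
      ≤ X.N (fun t => (1 + 5 ^ n) *
          hardyAvg (cutRearr volume fun x => ENNReal.ofReal |f x|) t) := by
        refine X.N_mono (measurable_cutRearr _).aemeasurable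
          ((measurable_hardyAvg _).const_mul _).aemeasurable fun t => ?_
        by_cases ht : 0 < t
        · rw [cutRearr_of_pos ht]
          exact distRearr_maximalFn_le hn hf (X.cutRearr_lt_top hfin') ht
        · simp [cutRearr_of_nonpos (not_lt.1 ht)]
    _ ≤ (1 + 5 ^ n) * (ENNReal.ofReal A * X.N (cutRearr volume fun x => ENNReal.ofReal |f x|)) := by
        rw [X.norm_smul]
        gcongr
        exact hbound _ _ hfin'
    _ = _ := by
        rw [ENNReal.ofReal_mul (by positivity), hcast, mul_assoc]
        rfl

section Radial

variable {n : ℕ}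

/-- The volume of the ball centered at the origin whose boundary contains `x`. -/
def radialVolume (x : EuclideanSpace ℝ (Fin n)) : ℝ :=
  (volume (Metric.ball (0 : EuclideanSpace ℝ (Fin n)) 1)).toReal * ‖x‖ ^ n

theorem volume_unitBall_toReal_pos :
    0 < (volume (Metric.ball (0 : EuclideanSpace ℝ (Fin n)) 1)).toReal :=
  ENNReal.toReal_pos (volume_ball_ne_zero _ one_pos) measure_ball_lt_top.ne

theorem radialVolume_nonneg (x : EuclideanSpace ℝ (Fin n)) : 0 ≤ radialVolume x := by
  unfold radialVolume; positivity

theorem measurable_radialVolume : Measurable (radialVolume (n := n)) := by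
  unfold radialVolume; fun_prop

theorem volume_radialVolume_preimage_Iic (hn : 0 < n) (b : ℝ) :
    volume (radialVolume (n := n) ⁻¹' Iic b) = ENNReal.ofReal b := by
  rcases lt_or_ge b 0 with hb | hb
  · have : radialVolume (n := n) ⁻¹' Iic b = ∅ := by
      ext x
      simpa using hb.trans_le (radialVolume_nonneg x)
    rw [this, measure_empty, ENNReal.ofReal_of_nonpos hb.le]
  have hω := volume_unitBall_toReal_pos (n := n)
  set ω := (volume (Metric.ball (0 : EuclideanSpace ℝ (Fin n)) 1)).toReal with hωdef
  set r : ℝ := (b / ω) ^ ((n : ℝ)⁻¹) with hr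
  have hr0 : 0 ≤ r := by positivity
  have hrn : r ^ n = b / ω := Real.rpow_inv_natCast_pow (by positivity) hn.ne'
  have : radialVolume (n := n) ⁻¹' Iic b = Metric.closedBall 0 r := by
    ext x
    rw [mem_preimage, mem_Iic, mem_closedBall_zero_iff,
      ← pow_le_pow_iff_left₀ (norm_nonneg x) hr0 hn.ne', hrn, le_div_iff₀ hω, mul_comm]
    rfl
  rw [this, volume_closedBall_eq _ hr0, hrn,
    ← ENNReal.ofReal_toReal (measure_ball_lt_top (x := (0 : EuclideanSpace ℝ (Fin n)))
      (r := 1) (μ := volume)).ne, ← hωdef, ← ENNReal.ofReal_mul (by positivity),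
    div_mul_cancel₀ _ hω.ne']

theorem measurePreserving_radialVolume (hn : 0 < n) :
    MeasurePreserving (radialVolume (n := n)) volume (volume.restrict (Ioi 0)) := by
  refine ⟨measurable_radialVolume, ?_⟩
  have hIoc : ∀ a b : ℝ, a < b → (volume.map (radialVolume (n := n))) (Ioc a b) =
      ENNReal.ofReal b - ENNReal.ofReal a := by
    intro a b hab
    have hset : Ioc a b = Iic b \ Iic a := by ext; simp [and_comm]
    rw [Measure.map_apply measurable_radialVolume measurableSet_Ioc, hset,
      preimage_sdiff, measure_sdiff (preimage_mono (Iic_subset_Iic.2 hab.le))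
        (measurable_radialVolume measurableSet_Iic).nullMeasurableSet
        (by rw [volume_radialVolume_preimage_Iic hn]; exact ENNReal.ofReal_ne_top),
      volume_radialVolume_preimage_Iic hn, volume_radialVolume_preimage_Iic hn]
  refine Measure.ext_of_Ioc' _ _ (fun a b hab => ?_) fun a b hab => ?_
  · rw [hIoc a b hab]
    exact ENNReal.sub_ne_top ENNReal.ofReal_ne_top
  · rw [hIoc a b hab, Measure.restrict_apply measurableSet_Ioc, Ioc_inter_Ioi, Real.volume_Ioc,
      ENNReal.ofReal_sub _ (le_max_right _ _)]
    rcases le_total a 0 with h | h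
    · rw [max_eq_right h, ENNReal.ofReal_of_nonpos h, ENNReal.ofReal_zero]
    · rw [max_eq_left h]

theorem volume_lt_comp_radialVolume (hn : 0 < n) {k : ℝ → ℝ≥0∞} (hk : Measurable k)
    (hk0 : ∀ s ≤ 0, k s = 0) (u : ℝ≥0∞) :
    volume {x : EuclideanSpace ℝ (Fin n) | u < k (radialVolume x)} = volume {s | u < k s} := by
  have hm : MeasurableSet {s | u < k s} := measurableSet_lt measurable_const hk
  have h := (measurePreserving_radialVolume hn).measure_preimage hm.nullMeasurableSet
  rw [Measure.restrict_apply hm, inter_eq_left.2] at h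
  · exact h
  · intro s hs
    by_contra hs0
    have hs' : u < k s := hs
    rw [hk0 s (not_lt.1 hs0)] at hs'
    exact not_lt_bot hs'

theorem hardyAvg_radialVolume_le (hn : 0 < n) {k : ℝ → ℝ≥0∞} (hk : Measurable k)
    {g : EuclideanSpace ℝ (Fin n) → ℝ≥0∞} (hg : ∀ᵐ x, g x = k (radialVolume x))
    (x : EuclideanSpace ℝ (Fin n)) :
    (2 ^ n)⁻¹ * hardyAvg k (radialVolume x) ≤ maximalE g x := by
  by_cases ht : 0 < radialVolume x
  swap
  · simp [hardyAvg, ht]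
  set t := radialVolume x with htdef
  have hω := volume_unitBall_toReal_pos (n := n)
  have hx : 0 < ‖x‖ := by
    rcases (norm_nonneg x).eq_or_lt with h | h
    · rw [htdef, radialVolume, ← h, zero_pow hn.ne', mul_zero] at ht
      exact absurd ht (lt_irrefl _)
    · exact h
  have hvol : volume (Metric.ball x (2 * ‖x‖)) = 2 ^ n * ENNReal.ofReal t := by
    rw [volume_ball_eq x (by positivity), htdef, radialVolume, ENNReal.ofReal_mul hω.le,
      ENNReal.ofReal_toReal measure_ball_lt_top.ne, mul_pow, ENNReal.ofReal_mul (by positivity),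
      ENNReal.ofReal_pow (by norm_num)]
    norm_num
    ring
  have hsub : radialVolume (n := n) ⁻¹' Ioo 0 t ⊆ Metric.ball x (2 * ‖x‖) := by
    intro y hy
    have h1 : radialVolume y < t := hy.2
    rw [htdef, radialVolume, radialVolume, mul_lt_mul_iff_right₀ hω] at h1
    have h2 : ‖y‖ < ‖x‖ := lt_of_pow_lt_pow_left₀ n hx.le h1
    rw [Metric.mem_ball, dist_eq_norm]
    linarith [norm_sub_le y x]
  have hint : ∫⁻ s in Ioo 0 t, k s ≤ ∫⁻ y in Metric.ball x (2 * ‖x‖), g y := by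
    calc ∫⁻ s in Ioo 0 t, k s = ∫⁻ s in Ioo 0 t, k s ∂(volume.restrict (Ioi 0)) := by
          rw [Measure.restrict_restrict measurableSet_Ioo,
            inter_eq_left.2 Ioo_subset_Ioi_self]
      _ = ∫⁻ y in radialVolume (n := n) ⁻¹' Ioo 0 t, k (radialVolume y) :=
          ((measurePreserving_radialVolume hn).setLIntegral_comp_preimage
            measurableSet_Ioo hk).symm
      _ = ∫⁻ y in radialVolume (n := n) ⁻¹' Ioo 0 t, g y :=
          lintegral_congr_ae (ae_restrict_of_ae (by filter_upwards [hg] with y hy using hy.symm))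
      _ ≤ _ := lintegral_mono_set hsub
  have hpow : (2 : ℝ≥0∞) ^ n ≠ 0 := by positivity
  calc (2 ^ n)⁻¹ * hardyAvg k t
      = (volume (Metric.ball x (2 * ‖x‖)))⁻¹ * ∫⁻ s in Ioo 0 t, k s := by
        rw [hardyAvg, if_pos ht, hvol, ENNReal.mul_inv (Or.inl hpow)
          (Or.inr (ENNReal.ofReal_pos.2 ht).ne'), ENNReal.ofReal_inv_of_pos ht, mul_assoc]
    _ ≤ (volume (Metric.ball x (2 * ‖x‖)))⁻¹ * ∫⁻ y in Metric.ball x (2 * ‖x‖), g y := by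
        gcongr
    _ ≤ _ := le_iSup₂ (f := fun (R : ℝ) (_ : 0 < R) =>
          (volume (Metric.ball x R))⁻¹ * ∫⁻ y in Metric.ball x R, g y) (2 * ‖x‖)
          (by positivity)

/-- Boundedness of the maximal operator on `X(ℝⁿ)` implies boundedness of the Hardy averaging
operator on `X`. -/
theorem N_hardyAvg_le_of_maximal_bounded (hn : 0 < n) (X : RIQB) {c : ℝ≥0∞}
    (H : ∀ f : EuclideanSpace ℝ (Fin n) → ℝ, AEMeasurable f volume →
      XnormRn X n (fun x => ENNReal.ofReal |f x|) < ∞ →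
        XnormRn X n (maximalFn f) ≤ c * XnormRn X n (fun x => ENNReal.ofReal |f x|))
    {k : ℝ → ℝ≥0∞} (hk : Measurable k) (hk0 : ∀ s ≤ 0, k s = 0) (hfin : X.N k < ∞) :
    X.N (hardyAvg k) ≤ 2 ^ n * c * X.N k := by
  set F : EuclideanSpace ℝ (Fin n) → ℝ := fun x => (k (radialVolume x)).toReal with hF
  set g : EuclideanSpace ℝ (Fin n) → ℝ≥0∞ := fun x => ENNReal.ofReal |F x| with hg
  have hFm : Measurable F := (hk.comp measurable_radialVolume).ennreal_toReal
  have hgk : ∀ᵐ x, g x = k (radialVolume x) := by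
    have h1 : ∀ᵐ s ∂(volume.restrict (Ioi (0 : ℝ))), k s < ∞ :=
      ae_restrict_of_ae (X.ae_lt_top hk.aemeasurable hfin)
    filter_upwards [(measurePreserving_radialVolume hn).quasiMeasurePreserving.ae h1] with x hx
    rw [hg]
    dsimp only
    rw [hF, abs_of_nonneg ENNReal.toReal_nonneg, ENNReal.ofReal_toReal hx.ne]
  have hNg : X.N (cutRearr volume g) = X.N k := by
    refine X.N_congr_distrib (measurable_cutRearr g).aemeasurable hk.aemeasurable fun u => ?_
    rw [volume_lt_cutRearr, ← volume_lt_comp_radialVolume hn hk hk0 u]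
    refine measure_congr ?_
    filter_upwards [hgk] with x hx
    exact congrArg (fun y => u < y) hx
  have hM : X.N (cutRearr volume (maximalFn F)) ≤ c * X.N k := by
    rw [← hNg]
    exact H F hFm.aemeasurable (by
      change X.N (cutRearr volume g) < ∞
      rwa [hNg])
  have hle : X.N (fun t => (2 ^ n)⁻¹ * hardyAvg k t) ≤ X.N (cutRearr volume (maximalFn F)) := by
    have hm : Measurable fun t => (2 ^ n)⁻¹ * hardyAvg k t := (measurable_hardyAvg k).const_mul _
    refine X.rearr_mono _ _ (measurable_cutRearr _).aemeasurable hm.aemeasurable fun s _ =>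
      distRearr_le_distRearr (fun u => ?_) s
    rw [volume_lt_cutRearr, ← volume_lt_comp_radialVolume hn hm
      (fun s hs => by simp [hardyAvg, hs.not_gt])]
    exact measure_mono fun x hx =>
      lt_of_lt_of_le hx (hardyAvg_radialVolume_le hn hk hgk x)
  rw [X.norm_smul] at hle
  have hpow : (2 : ℝ≥0∞) ^ n ≠ 0 := by positivity
  have hpowt : (2 : ℝ≥0∞) ^ n ≠ ∞ := by finiteness
  calc X.N (hardyAvg k) = 2 ^ n * ((2 ^ n)⁻¹ * X.N (hardyAvg k)) := by
        rw [← mul_assoc, ENNReal.mul_inv_cancel hpow hpowt, one_mul]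
    _ ≤ 2 ^ n * (c * X.N k) := by exact mul_le_mul_right (hle.trans hM) _
    _ = _ := by ring

end Radial

theorem lintegral_Ioo_ofReal_inv {a b : ℝ} (ha : 0 < a) (hab : a ≤ b) :
    ∫⁻ s in Ioo a b, ENNReal.ofReal s⁻¹ = ENNReal.ofReal (Real.log (b / a)) := by
  have hint : IntervalIntegrable (fun s : ℝ => s⁻¹) volume a b :=
    intervalIntegrable_inv_iff.2 <| Or.inr fun h => by
      rw [uIcc_of_le hab] at h
      exact absurd h.1 (not_le.2 ha)
  rw [← integral_inv_of_pos ha (ha.trans_le hab), intervalIntegral.integral_of_le hab,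
    ← restrict_Ioo_eq_restrict_Ioc,
    ofReal_integral_eq_lintegral_ofReal
      ((intervalIntegrable_iff_integrableOn_Ioo_of_le hab).1 hint)]
  filter_upwards [ae_restrict_mem measurableSet_Ioo] with s hs
  exact (inv_pos.2 (ha.trans hs.1)).le

theorem le_hardyAvg_hardyAvg {α : Type*} [MeasurableSpace α] {μ : Measure α} (g : α → ℝ≥0∞)
    {a : ℝ} (ha0 : 0 < a) (ha1 : a < 1) (t : ℝ) :
    ENNReal.ofReal (a * Real.log a⁻¹) * cutRearr μ g (a * t) ≤
      hardyAvg (hardyAvg (cutRearr μ g)) t := by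
  by_cases ht : 0 < t
  swap
  · rw [cutRearr_of_nonpos (mul_nonpos_of_nonneg_of_nonpos ha0.le (not_lt.1 ht)), mul_zero]
    exact bot_le
  have hat : 0 < a * t := mul_pos ha0 ht
  have hat' : a * t ≤ t := by nlinarith
  set w := cutRearr μ g (a * t) with hw
  have hw' : ENNReal.ofReal (a * t) * w ≤ ∫⁻ s in Ioo 0 (a * t), cutRearr μ g s := by
    calc ENNReal.ofReal (a * t) * w = ∫⁻ _ in Ioo 0 (a * t), w := by
          rw [setLIntegral_const, Real.volume_Ioo, sub_zero, mul_comm]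
      _ ≤ _ := setLIntegral_mono' measurableSet_Ioo fun s hs => by
          rw [hw, cutRearr_of_pos hat, cutRearr_of_pos hs.1]
          exact distRearr_antitone g hs.2.le
  have hinner : ∀ s ∈ Ioo (a * t) t, ENNReal.ofReal s⁻¹ * (ENNReal.ofReal (a * t) * w) ≤
      hardyAvg (cutRearr μ g) s := by
    intro s hs
    rw [hardyAvg, if_pos (hat.trans hs.1)]
    gcongr
    exact hw'.trans (lintegral_mono_set (Ioo_subset_Ioo_right hs.1.le))
  rw [hardyAvg, if_pos ht]
  calc ENNReal.ofReal (a * Real.log a⁻¹) * w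
      = ENNReal.ofReal t⁻¹ *
        (ENNReal.ofReal (Real.log (t / (a * t))) * (ENNReal.ofReal (a * t) * w)) := by
        have hlog : 0 < Real.log a⁻¹ := Real.log_pos ((one_lt_inv₀ ha0).2 ha1)
        have hta : t / (a * t) = a⁻¹ := by field_simp
        rw [hta, ← mul_assoc, ← mul_assoc, ← ENNReal.ofReal_mul (by positivity),
          ← ENNReal.ofReal_mul (by positivity)]
        congr 2
        field_simp
    _ = ENNReal.ofReal t⁻¹ *
        ∫⁻ s in Ioo (a * t) t, ENNReal.ofReal s⁻¹ * (ENNReal.ofReal (a * t) * w) := by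
        rw [lintegral_mul_const _ measurable_inv.ennreal_ofReal, lintegral_Ioo_ofReal_inv hat hat']
    _ ≤ ENNReal.ofReal t⁻¹ * ∫⁻ s in Ioo (a * t) t, hardyAvg (cutRearr μ g) s := by
        exact mul_le_mul_right (setLIntegral_mono' measurableSet_Ioo hinner) _
    _ ≤ _ := by
        exact mul_le_mul_right (lintegral_mono_set (Ioo_subset_Ioo_left hat.le)) _

theorem aemeasurable_dil {f : ℝ → ℝ} (hf : AEMeasurable f volume) {a : ℝ} (ha : 0 < a) :
    AEMeasurable (dil a f) volume := by
  refine hf.comp_quasiMeasurePreserving ⟨measurable_const_mul a, ?_⟩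
  refine Measure.AbsolutelyContinuous.mk fun s hs h0 => ?_
  rw [Measure.map_apply (measurable_const_mul a) hs, Real.volume_preimage_mul_left ha.ne', h0,
    mul_zero]

theorem volume_lt_comp_mul (k : ℝ → ℝ≥0∞) {a : ℝ} (ha : 0 < a) (u : ℝ≥0∞) :
    volume {x | u < k (a * x)} = ENNReal.ofReal a⁻¹ * volume {x | u < k x} := by
  have := Real.volume_preimage_mul_left ha.ne' {x | u < k x}
  rwa [abs_of_pos (inv_pos.2 ha)] at this

namespace RIQB

variable (X : RIQB)

theorem Nr_dil_anti {f : ℝ → ℝ} (hf : AEMeasurable f volume) {a b : ℝ} (ha : 0 < a)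
    (hab : a ≤ b) : X.Nr (dil b f) ≤ X.Nr (dil a f) := by
  refine X.rearr_mono _ _ (aemeasurable_dil hf ha).abs.ennreal_ofReal
    (aemeasurable_dil hf (ha.trans_le hab)).abs.ennreal_ofReal fun s _ =>
    distRearr_le_distRearr (fun u => ?_) s
  have h1 := volume_lt_comp_mul (fun x => ENNReal.ofReal |f x|) ha u
  have h2 := volume_lt_comp_mul (fun x => ENNReal.ofReal |f x|) (ha.trans_le hab) u
  calc _ = _ := h2
    _ ≤ ENNReal.ofReal a⁻¹ * volume {x | u < ENNReal.ofReal |f x|} := by gcongr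
    _ = _ := h1.symm

theorem Nr_dil_eq {f : ℝ → ℝ} (hf : AEMeasurable f volume) {a : ℝ} (ha : 0 < a) :
    X.Nr (dil a f) =
      X.N fun t => cutRearr volume (fun x => ENNReal.ofReal |f x|) (a * t) := by
  refine X.N_congr_distrib (aemeasurable_dil hf ha).abs.ennreal_ofReal
    ((measurable_cutRearr _).comp (measurable_const_mul a)).aemeasurable fun u => ?_
  rw [volume_lt_comp_mul _ ha, volume_lt_cutRearr]
  exact volume_lt_comp_mul (fun x => ENNReal.ofReal |f x|) ha u

theorem Nr_dil_pow_le {b : ℝ} (hb : 0 < b) {q : ℝ≥0∞} (hq : q ≠ ∞)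
    (H : ∀ f : ℝ → ℝ, AEMeasurable f volume → X.Nr f < ∞ → X.Nr (dil b f) ≤ q * X.Nr f)
    (m : ℕ) {f : ℝ → ℝ} (hf : AEMeasurable f volume) (hfin : X.Nr f < ∞) :
    X.Nr (dil (b ^ m) f) ≤ q ^ m * X.Nr f := by
  induction m with
  | zero =>
    have : dil (b ^ 0) f = f := by funext x; simp [dil]
    rw [this, pow_zero, one_mul]
  | succ m ih =>
    have : dil (b ^ (m + 1)) f = dil b (dil (b ^ m) f) := by
      funext x
      simp only [dil]
      ring_nf
    rw [this]
    refine (H _ (aemeasurable_dil hf (by positivity)) (ih.trans_lt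
      (ENNReal.mul_lt_top (ENNReal.pow_lt_top hq.lt_top) hfin))).trans ?_
    calc q * X.Nr (dil (b ^ m) f) ≤ q * (q ^ m * X.Nr f) := by gcongr
      _ = _ := by ring

/-- A single dilation with norm less than its critical value `b⁻¹` forces a lower Boyd index
larger than one. -/
theorem one_lt_lowerBoyd_of_dil_le {b ρ : ℝ} (hb0 : 0 < b) (hb1 : b < 1) (hρ0 : 0 < ρ)
    (hρ1 : ρ < 1)
    (H : ∀ f : ℝ → ℝ, AEMeasurable f volume → X.Nr f < ∞ →
      X.Nr (dil b f) ≤ ENNReal.ofReal (b ^ (-ρ)) * X.Nr f) :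
    1 < lowerBoyd X := by
  have hp : 1 < ENNReal.ofReal ρ⁻¹ := ENNReal.one_lt_ofReal.2 ((one_lt_inv₀ hρ0).2 hρ1)
  refine hp.trans_le ?_
  refine le_iSup₂_of_le (f := fun (p : ℝ) (_ : p ∈ {p : ℝ | 0 < p ∧ ∃ c : ℝ, 0 < c ∧
      ∀ a : ℝ, 0 < a → a < 1 → ∀ f : ℝ → ℝ, AEMeasurable f volume → X.Nr f < ∞ →
        X.Nr (dil a f) ≤ ENNReal.ofReal (c * a ^ (-(1/p))) * X.Nr f}) => ENNReal.ofReal p)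
    ρ⁻¹ ⟨inv_pos.2 hρ0, b ^ (-ρ), by positivity, ?_⟩ le_rfl
  intro a ha0 ha1 f hf hfin
  obtain ⟨m, hm1, hm2⟩ := exists_nat_pow_near_of_lt_one ha0 ha1.le hb0 hb1
  refine (X.Nr_dil_anti hf (by positivity) hm1.le).trans ?_
  refine (X.Nr_dil_pow_le hb0 ENNReal.ofReal_ne_top H (m + 1) hf hfin).trans ?_
  rw [← ENNReal.ofReal_pow (by positivity)]
  gcongr
  rw [one_div, inv_inv, ← Real.mul_rpow hb0.le ha0.le, ← Real.rpow_natCast,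
    ← Real.rpow_mul hb0.le, mul_comm (-ρ), Real.rpow_mul hb0.le, Real.rpow_natCast]
  refine Real.rpow_le_rpow_of_nonpos (by positivity) ?_ (by linarith)
  rw [pow_succ, mul_comm b a]
  gcongr

end RIQB

theorem one_lt_lowerBoyd_of_maximal_bounded {n : ℕ} (hn : 0 < n) (X : RIQB) {c : ℝ}
    (H : ∀ f : EuclideanSpace ℝ (Fin n) → ℝ, AEMeasurable f volume →
      XnormRn X n (fun x => ENNReal.ofReal |f x|) < ∞ →
        XnormRn X n (maximalFn f) ≤
          ENNReal.ofReal c * XnormRn X n (fun x => ENNReal.ofReal |f x|)) :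
    1 < lowerBoyd X := by
  set A : ℝ := max 1 (2 ^ n * c) with hA
  have hA1 : 1 ≤ A := le_max_left _ _
  have hAvg : ∀ {k : ℝ → ℝ≥0∞}, Measurable k → (∀ s ≤ 0, k s = 0) → X.N k < ∞ →
      X.N (hardyAvg k) ≤ ENNReal.ofReal A * X.N k := by
    intro k hk hk0 hfin
    refine (N_hardyAvg_le_of_maximal_bounded hn X H hk hk0 hfin).trans ?_
    gcongr
    calc (2 : ℝ≥0∞) ^ n * ENNReal.ofReal c = ENNReal.ofReal (2 ^ n * c) := by
          rw [ENNReal.ofReal_mul (by positivity), ENNReal.ofReal_pow (by norm_num)]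
          norm_num
      _ ≤ _ := ENNReal.ofReal_le_ofReal (le_max_right _ _)
  set L : ℝ := 2 * A ^ 2 with hL
  have hL2 : 2 ≤ L := by nlinarith
  have hlog2 : Real.log 2 < 1 := by linarith [Real.log_two_lt_d9]
  have hlog2' : 0 < Real.log 2 := Real.log_pos (by norm_num)
  have hb0 : 0 < Real.exp (-L) := Real.exp_pos _
  have hb1 : Real.exp (-L) < 1 := Real.exp_lt_one_iff.2 (by linarith)
  refine X.one_lt_lowerBoyd_of_dil_le (ρ := 1 - Real.log 2 / L) hb0 hb1 ?_ ?_ ?_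
  · rw [sub_pos, div_lt_one (by linarith)]
    linarith
  · have : 0 < Real.log 2 / L := by positivity
    linarith
  intro f hf hfin
  set b := Real.exp (-L) with hb
  have hpow : b ^ (-(1 - Real.log 2 / L)) = (2 * b)⁻¹ := by
    rw [hb, ← Real.exp_mul]
    have : -L * -(1 - Real.log 2 / L) = L - Real.log 2 := by field_simp
    rw [this, Real.exp_sub, Real.exp_log (by norm_num), Real.exp_neg]
    field_simp
  set k := cutRearr volume fun x => ENNReal.ofReal |f x| with hk
  have hkm : Measurable k := measurable_cutRearr _
  have hNk : X.N k = X.Nr f := X.N_cutRearr hf.abs.ennreal_ofReal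
  have hkfin : X.N k < ∞ := hNk ▸ hfin
  have h1 := hAvg hkm (fun s hs => cutRearr_of_nonpos hs) hkfin
  have h2 := hAvg (measurable_hardyAvg k) (fun s hs => by simp [hardyAvg, hs.not_gt])
    (h1.trans_lt (ENNReal.mul_lt_top ENNReal.ofReal_lt_top hkfin))
  have h3 : X.N (fun t => ENNReal.ofReal (b * Real.log b⁻¹) * k (b * t)) ≤
      X.N (hardyAvg (hardyAvg k)) :=
    X.N_mono ((hkm.comp (measurable_const_mul b)).const_mul _).aemeasurable
      (measurable_hardyAvg _).aemeasurable fun t => le_hardyAvg_hardyAvg _ hb0 hb1 t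
  have hlogb : Real.log b⁻¹ = L := by rw [Real.log_inv, hb, Real.log_exp, neg_neg]
  rw [X.norm_smul, ← X.Nr_dil_eq hf hb0, hlogb] at h3
  have hbL : 0 < b * L := by positivity
  rw [hpow, ← hNk]
  calc X.Nr (dil b f)
      = ENNReal.ofReal (b * L)⁻¹ * (ENNReal.ofReal (b * L) * X.Nr (dil b f)) := by
        rw [← mul_assoc, ← ENNReal.ofReal_mul (by positivity), inv_mul_cancel₀ hbL.ne',
          ENNReal.ofReal_one, one_mul]
    _ ≤ ENNReal.ofReal (b * L)⁻¹ * (ENNReal.ofReal A * (ENNReal.ofReal A * X.N k)) :=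
        mul_le_mul_right (h3.trans (h2.trans (mul_le_mul_right h1 _))) _
    _ = ENNReal.ofReal (2 * b)⁻¹ * X.N k := by
        rw [← mul_assoc, ← mul_assoc, ← ENNReal.ofReal_mul (by positivity),
          ← ENNReal.ofReal_mul (by positivity)]
        congr 2
        rw [hL]
        field_simp

/-- **Theorem 5.** The Hardy--Littlewood maximal operator is bounded on `X(ℝⁿ)`
if and only if `p_X > 1`. -/
theorem maximal_bounded_iff_one_lt_lowerBoyd (n : ℕ) (hn : 0 < n) (X : RIQB) :
    (∃ c : ℝ, 0 < c ∧ ∀ f : EuclideanSpace ℝ (Fin n) → ℝ, AEMeasurable f volume →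
      XnormRn X n (fun x => ENNReal.ofReal |f x|) < ∞ →
        XnormRn X n (maximalFn f) ≤
          ENNReal.ofReal c * XnormRn X n (fun x => ENNReal.ofReal |f x|)) ↔
    1 < lowerBoyd X := by
  constructor
  · rintro ⟨c, -, H⟩
    exact one_lt_lowerBoyd_of_maximal_bounded hn X H
  · exact maximal_bounded_of_one_lt_lowerBoyd hn X

end
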